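/- Let N be an even positive integer and let i, j, k be integers with 2 ≤ i ≤ j ≤ k ≤ N/2 − 1 and i + j + k = N. Then the partial sums ∑_{l=1}^{M} (−1)^l ((2 + (−1)^l)/l) sin(πli/N) sin(πlj/N) sin(πlk/N) tend to 0 as M → ∞. -/

import Mathlib

open Real Filter

lemma aux_cauchy (w : ℂ) (hw : ‖w‖ = 1) (h1 : w ≠ 1) :
    CauchySeq (fun M : ℕ => ∑ n ∈ Finset.range M, w ^ (n+1) / ((n+1 : ℕ) : ℂ)) := by
  have hf : Antitone (fun n : ℕ => (1 : ℝ) / ((n : ℝ) + 1)) := by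
    intro a b hab
    have : (a : ℝ) ≤ b := by exact_mod_cast hab
    exact one_div_le_one_div_of_le (by positivity) (by linarith)
  have h := hf.cauchySeq_series_mul_of_tendsto_zero_of_bounded
    (z := fun n => w ^ (n+1)) (b := 2 / ‖w - 1‖) tendsto_one_div_add_atTop_nhds_zero_nat (by
      intro n
      have : ∑ i ∈ Finset.range n, w ^ (i+1) = w * ((w ^ n - 1) / (w - 1)) := by
        rw [← geom_sum_eq h1, Finset.mul_sum]
        exact Finset.sum_congr rfl fun i _ => by ring
      rw [this, norm_mul, norm_div, hw, one_mul]
      gcongr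
      calc ‖w ^ n - 1‖ ≤ ‖w ^ n‖ + ‖(1 : ℂ)‖ := norm_sub_le _ _
        _ = 2 := by rw [norm_pow, hw]; norm_num)
  convert h using 4 with M n
  rw [Complex.real_smul]
  push_cast
  ring

lemma aux_log (w : ℂ) (hw : ‖w‖ = 1) (h1 : w ≠ 1) :
    Tendsto (fun M : ℕ => ∑ n ∈ Finset.range M, w ^ n / (n : ℂ)) atTop
      (nhds (-Complex.log (1 - w))) := by
  obtain ⟨l, hl⟩ := cauchySeq_tendsto_of_complete (aux_cauchy w hw h1)
  have hl' : Tendsto (fun M : ℕ => ∑ n ∈ Finset.range M, w ^ n / (n : ℂ)) atTop (nhds l) := by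
    rw [← tendsto_add_atTop_iff_nat 1]
    refine hl.congr fun M => ?_
    rw [Finset.sum_range_succ' _ M]
    simp
  have hA := Complex.tendsto_tsum_powerSeries_nhdsWithin_lt hl'
  rw [tendsto_map'_iff] at hA
  have hre : w.re < 1 := by
    refine lt_of_le_of_ne (hw ▸ Complex.re_le_norm w) fun h => h1 ?_
    have h3 := Complex.sq_norm w
    rw [hw, Complex.normSq_apply, h] at h3
    have : w.im = 0 := by nlinarith
    exact Complex.ext (by simpa using h) (by simpa using this)
  have hB : Tendsto (fun r : ℝ => -Complex.log (1 - w * r)) (nhdsWithin 1 (Set.Iio 1))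
      (nhds (-Complex.log (1 - w))) := by
    have : ContinuousAt (fun r : ℝ => -Complex.log (1 - w * r)) 1 := by
      refine (ContinuousAt.clog (by fun_prop) ?_).neg
      left
      simpa using hre
    have := this.tendsto
    simp only [Complex.ofReal_one, mul_one] at this
    exact this.mono_left nhdsWithin_le_nhds
  have : l = -Complex.log (1 - w) := by
    refine tendsto_nhds_unique (hA.congr' ?_) hB
    filter_upwards [Ioo_mem_nhdsLT (show (0:ℝ) < 1 by norm_num)] with r hr
    have := Complex.hasSum_taylorSeries_neg_log (z := w * r) (by
      rw [norm_mul, hw, one_mul, Complex.norm_real, Real.norm_eq_abs, abs_of_pos hr.1]; exact hr.2)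
    rw [← this.tsum_eq]
    refine tsum_congr fun n => ?_
    simp only [mul_pow]; ring
  exact this ▸ hl'

lemma aux_sin (x : ℝ) (h0 : 0 < x) (h1 : x < 2 * π) :
    Tendsto (fun M : ℕ => ∑ l ∈ Finset.Icc 1 M, Real.sin (l * x) / l) atTop
      (nhds ((π - x) / 2)) := by
  have hs : 0 < Real.sin (x/2) := Real.sin_pos_of_pos_of_lt_pi (by linarith) (by linarith)
  have hpol : 1 - Complex.exp (x * Complex.I) = ((2 * Real.sin (x/2) : ℝ) : ℂ) *
      (Complex.cos (((x - π)/2 : ℝ)) + Complex.sin (((x - π)/2 : ℝ)) * Complex.I) := by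
    have e1 : Real.cos ((x - π)/2) = Real.sin (x/2) := by
      rw [show (x - π)/2 = x/2 - π/2 by ring, Real.cos_sub_pi_div_two]
    have e2 : Real.sin ((x - π)/2) = -Real.cos (x/2) := by
      rw [show (x - π)/2 = x/2 - π/2 by ring, Real.sin_sub_pi_div_two]
    rw [Complex.exp_mul_I, ← Complex.ofReal_cos, ← Complex.ofReal_sin, ← Complex.ofReal_cos,
      ← Complex.ofReal_sin, e1, e2]
    have c : Real.cos x = 1 - 2 * Real.sin (x/2) ^ 2 := by
      rw [show x = 2 * (x/2) by ring, Real.cos_two_mul, Real.cos_sq']; ring_nf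
    have s : Real.sin x = 2 * Real.sin (x/2) * Real.cos (x/2) := by
      rw [← Real.sin_two_mul]; ring_nf
    rw [c, s]; push_cast; ring
  have harg : (Complex.log (1 - Complex.exp (x * Complex.I))).im = (x - π)/2 := by
    rw [Complex.log_im, hpol]
    exact Complex.arg_mul_cos_add_sin_mul_I (by positivity) ⟨by linarith, by linarith⟩
  have hne : Complex.exp (x * Complex.I) ≠ 1 := by
    intro h
    have : (1 : ℂ) - Complex.exp (x * Complex.I) = 0 := by rw [h]; ring
    rw [this] at harg
    have hx : x = π := by simp at harg; linarith
    rw [hx, Complex.exp_pi_mul_I] at h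
    norm_num at h
  have h := aux_log _ (Complex.norm_exp_ofReal_mul_I x) hne
  have h2 := (Complex.continuous_im.tendsto _).comp h
  rw [Complex.neg_im, harg, ← tendsto_add_atTop_iff_nat 1] at h2
  rw [show (π - x)/2 = -((x - π)/2) by ring]
  refine h2.congr fun M => ?_
  simp only [Function.comp, Complex.im_sum]
  rw [Finset.range_eq_Ico, Finset.sum_eq_sum_Ico_succ_bot (by omega)]
  simp only [Nat.cast_zero, div_zero, Complex.zero_im, zero_add]
  refine Finset.sum_congr (by ext; simp [Nat.lt_succ_iff, Nat.succ_le_iff] <;> omega) fun l _ => ?_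
  rw [← Complex.exp_nat_mul, ← mul_assoc, ← Complex.ofReal_natCast, Complex.div_ofReal_im,
    ← Complex.ofReal_mul, Complex.exp_ofReal_mul_I_im]

lemma aux_one (c : ℝ) (h0 : 0 < c) (h1 : c < π / 2) :
    Tendsto (fun M : ℕ => ∑ l ∈ Finset.Icc 1 M,
      (2 * (Real.sin (l * (2*c)) / l) + Real.sin (l * (2*c+π)) / l)) atTop
      (nhds (π - 3 * c)) := by
  have := ((aux_sin (2*c) (by linarith) (by linarith)).const_mul 2).add
    (aux_sin (2*c+π) (by linarith) (by linarith))
  rw [show π - 3 * c = 2 * ((π - 2*c)/2) + (π - (2*c+π))/2 by ring]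
  refine this.congr fun M => ?_
  rw [Finset.sum_add_distrib, Finset.mul_sum]

lemma aux_trig (A B C e : ℝ) (l : ℕ) (he : e = (-1) ^ l) (h : A + B + C = l * π) :
    -4 * (Real.sin A * Real.sin B * Real.sin C) =
      e * (Real.sin (2*A) + Real.sin (2*B) + Real.sin (2*C)) := by
  have he2 : e * e = 1 := by rw [he, ← mul_pow]; norm_num
  have hC : C = l * π - (A + B) := by linarith
  have hs : Real.sin C = -(e * Real.sin (A + B)) := by
    rw [hC, Real.sin_nat_mul_pi_sub, he]
  have hc : Real.cos C = e * Real.cos (A + B) := by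
    rw [hC, Real.cos_nat_mul_pi_sub, he]
  rw [Real.sin_two_mul C, hs, hc, Real.sin_two_mul, Real.sin_two_mul, Real.sin_add, Real.cos_add]
  have a := Real.sin_sq_add_cos_sq A
  have b := Real.sin_sq_add_cos_sq B
  have a' : Real.cos A ^ 2 = 1 - Real.sin A ^ 2 := by linarith
  have b' : Real.cos B ^ 2 = 1 - Real.sin B ^ 2 := by linarith
  linear_combination (exp := 1) (2 * e * (Real.sin A * Real.cos B + Real.cos A * Real.sin B) * (Real.cos A * Real.cos B - Real.sin A * Real.sin B)) * he2 + (2 * e * Real.sin B * Real.cos B) * a + (2 * e * Real.sin A * Real.cos A) * b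

/-- The umklapp-free symmetry condition (Eq. (3.1.2) of the paper, with infinite interaction
range): for an even lattice size `N` and mode numbers `2 ≤ i ≤ j ≤ k ≤ N/2 − 1` with
`i + j + k = N`, the series `∑ (−1)^l ((2 + (−1)^l)/l) sin(πli/N) sin(πlj/N) sin(πlk/N)`
converges to `0`. -/
theorem stmt_2 (N i j k : ℕ) (hN : 0 < N) (hNeven : Even N) (h2 : 2 ≤ i) (hij : i ≤ j)
    (hjk : j ≤ k) (hk : k ≤ N / 2 - 1) (hsum : i + j + k = N) :
    Tendsto
      (fun M : ℕ => ∑ l ∈ Finset.Icc 1 M,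
        (-1 : ℝ) ^ l * ((2 + (-1 : ℝ) ^ l) / l) *
          (Real.sin (π * l * i / N) * Real.sin (π * l * j / N) * Real.sin (π * l * k / N)))
      atTop (nhds 0) := by
  have hNr : (0 : ℝ) < N := by exact_mod_cast hN
  have hpi := Real.pi_pos
  have key : ∀ m : ℕ, 2 ≤ m → m ≤ k → 0 < π * m / N ∧ π * m / N < π / 2 := by
    intro m hm hmk
    have hm0 : (0 : ℝ) < m := by exact_mod_cast (by omega : 0 < m)
    have hm1 : (2 : ℝ) * m < N := by exact_mod_cast (by omega : 2 * m < N)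
    refine ⟨by positivity, ?_⟩
    rw [div_lt_iff₀ hNr]
    nlinarith
  have hi := key i h2 (by omega)
  have hj := key j (by omega) hjk
  have hk' := key k (by omega) le_rfl
  have hs : (i : ℝ) + j + k = N := by exact_mod_cast hsum
  have hS : π * i / N + π * j / N + π * k / N = π := by
    rw [← add_div, ← add_div, ← mul_add, ← mul_add, hs]
    field_simp
  have H := (((aux_one _ hi.1 hi.2).add (aux_one _ hj.1 hj.2)).add
    (aux_one _ hk'.1 hk'.2)).const_mul (-1/4)
  rw [show (-1/4) * (π - 3 * (π * i / N) + (π - 3 * (π * j / N)) + (π - 3 * (π * k / N))) = 0 by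
    linear_combination (3/4) * hS] at H
  refine H.congr fun M => ?_
  rw [← Finset.sum_add_distrib, ← Finset.sum_add_distrib, Finset.mul_sum]
  refine Finset.sum_congr rfl fun l _ => ?_
  have ht := aux_trig (π * l * i / N) (π * l * j / N) (π * l * k / N) _ l rfl (by
    linear_combination (l : ℝ) * hS)
  have hsh : ∀ m : ℕ, Real.sin (l * (2 * (π * m / N) + π)) =
      (-1) ^ l * Real.sin (2 * (π * l * m / N)) := by
    intro m
    rw [← Real.sin_add_nat_mul_pi]
    ring_nf
  have hsh2 : ∀ m : ℕ, Real.sin (l * (2 * (π * m / N))) = Real.sin (2 * (π * l * m / N)) := by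
    intro m
    ring_nf
  have he2 : ((-1 : ℝ) ^ l) * (-1) ^ l = 1 := by rw [← mul_pow]; norm_num
  rw [hsh, hsh, hsh, hsh2, hsh2, hsh2]
  generalize (-1 : ℝ) ^ l = e at *
  linear_combination (1/4) * (e * ((2 + e) / l)) * ht + (1/4) * ((2 + e) / l) * (Real.sin (2 * (π * l * i / N)) + Real.sin (2 * (π * l * j / N)) + Real.sin (2 * (π * l * k / N))) * he2
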